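/- If R is a ring with l.Ggldim(R) < ∞, then GP(R)^⊥ = {R-modules of finite projective dimension} = {R-modules of finite injective dimension} = ^⊥GI(R). -/

import Mathlib

universe u

open CategoryTheory

/-- `extVanish R n M N` asserts that `Ext_R^n(M, N) = 0`. -/
def extVanish (R : Type u) [Ring R] (n : ℕ) (M N : ModuleCat.{u} R) : Prop :=
  letI := HasDerivedCategory.standard (ModuleCat.{u} R)
  letI : HasExt.{u + 1} (ModuleCat.{u} R) := hasExt_of_hasDerivedCategory _
  Subsingleton (Abelian.Ext M N n)

/-- A module `G` is Gorenstein projective if there is an exact sequence of projective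
modules `⋯ → P i → P (i+1) → ⋯` with `G ≅ Im (d 0)` which stays exact after applying
`Hom_R(−, Q)` for every projective module `Q`. -/
def IsGorensteinProjective (R : Type u) [Ring R] (G : ModuleCat.{u} R) : Prop :=
  ∃ (P : ℤ → ModuleCat.{u} R) (d : ∀ i : ℤ, P i →ₗ[R] P (i + 1)),
    (∀ i, Module.Projective R (P i)) ∧
    (∀ i, LinearMap.range (d i) = LinearMap.ker (d (i + 1))) ∧
    Nonempty (G ≃ₗ[R] LinearMap.range (d 0)) ∧
    ∀ (Q : ModuleCat.{u} R), Module.Projective R Q →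
      ∀ (i : ℤ) (f : P (i + 1) →ₗ[R] Q), f ∘ₗ d i = 0 →
        ∃ g : P (i + 1 + 1) →ₗ[R] Q, g ∘ₗ d (i + 1) = f

/-- A module `G` is Gorenstein injective if there is an exact sequence of injective
modules `⋯ → I i → I (i+1) → ⋯` with `G ≅ Im (d 0)` which stays exact after applying
`Hom_R(E, −)` for every injective module `E`. -/
def IsGorensteinInjective (R : Type u) [Ring R] (G : ModuleCat.{u} R) : Prop :=
  ∃ (I : ℤ → ModuleCat.{u} R) (d : ∀ i : ℤ, I i →ₗ[R] I (i + 1)),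
    (∀ i, Module.Injective R (I i)) ∧
    (∀ i, LinearMap.range (d i) = LinearMap.ker (d (i + 1))) ∧
    Nonempty (G ≃ₗ[R] LinearMap.range (d 0)) ∧
    ∀ (E : ModuleCat.{u} R), Module.Injective R E →
      ∀ (i : ℤ) (f : E →ₗ[R] I (i + 1)), d (i + 1) ∘ₗ f = 0 →
        ∃ g : E →ₗ[R] I i, d i ∘ₗ g = f

/-- `gpdLE R n M` means that `M` admits a resolution `0 → Gₙ → ⋯ → G₀ → M → 0` by
Gorenstein projective modules, i.e. the Gorenstein projective dimension of `M` is at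
most `n`. -/
def gpdLE (R : Type u) [Ring R] : ℕ → ModuleCat.{u} R → Prop
  | 0, M => IsGorensteinProjective R M
  | n + 1, M => ∃ (K G : ModuleCat.{u} R) (f : K →ₗ[R] G) (g : G →ₗ[R] M),
      IsGorensteinProjective R G ∧ Function.Injective f ∧ Function.Surjective g ∧
      LinearMap.range f = LinearMap.ker g ∧ gpdLE R n K

/-- `gidLE R n M` means that `M` admits a coresolution `0 → M → G⁰ → ⋯ → Gⁿ → 0` by
Gorenstein injective modules, i.e. the Gorenstein injective dimension of `M` is at
most `n`. -/
def gidLE (R : Type u) [Ring R] : ℕ → ModuleCat.{u} R → Prop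
  | 0, M => IsGorensteinInjective R M
  | n + 1, M => ∃ (G C : ModuleCat.{u} R) (f : M →ₗ[R] G) (g : G →ₗ[R] C),
      IsGorensteinInjective R G ∧ Function.Injective f ∧ Function.Surjective g ∧
      LinearMap.range f = LinearMap.ker g ∧ gidLE R n C

/-- `projDimLE R n M` means that `M` admits a projective resolution of length at most `n`,
i.e. the projective dimension of `M` is at most `n`. -/
def projDimLE (R : Type u) [Ring R] : ℕ → ModuleCat.{u} R → Prop
  | 0, M => Module.Projective R M
  | n + 1, M => ∃ (K P : ModuleCat.{u} R) (f : K →ₗ[R] P) (g : P →ₗ[R] M),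
      Module.Projective R P ∧ Function.Injective f ∧ Function.Surjective g ∧
      LinearMap.range f = LinearMap.ker g ∧ projDimLE R n K

/-- `injDimLE R n M` means that `M` admits an injective resolution of length at most `n`,
i.e. the injective dimension of `M` is at most `n`. -/
def injDimLE (R : Type u) [Ring R] : ℕ → ModuleCat.{u} R → Prop
  | 0, M => Module.Injective R M
  | n + 1, M => ∃ (I C : ModuleCat.{u} R) (f : M →ₗ[R] I) (g : I →ₗ[R] C),
      Module.Injective R I ∧ Function.Injective f ∧ Function.Surjective g ∧
      LinearMap.range f = LinearMap.ker g ∧ injDimLE R n C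

section ExtVanishing

variable {C : Type*} [Category C] [Abelian C] {S : ShortComplex C}

open Abelian

namespace CategoryTheory.ShortComplex.ShortExact

variable [HasExt C] {n : ℕ}

lemma subsingleton_ext_X₂_left (hS : S.ShortExact) {Y : C} (h₁ : Subsingleton (Ext S.X₁ Y n))
    (h₃ : Subsingleton (Ext S.X₃ Y n)) : Subsingleton (Ext S.X₂ Y n) := by
  refine subsingleton_of_forall_eq 0 fun x => ?_
  obtain ⟨y, rfl⟩ := Ext.contravariant_sequence_exact₂ hS Y x (Subsingleton.elim _ _)
  rw [Subsingleton.elim y 0, Ext.comp_zero]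

lemma subsingleton_ext_X₃_left (hS : S.ShortExact) {Y : C} (h₁ : Subsingleton (Ext S.X₁ Y n))
    (h₂ : Subsingleton (Ext S.X₂ Y (n + 1))) : Subsingleton (Ext S.X₃ Y (n + 1)) := by
  refine subsingleton_of_forall_eq 0 fun x => ?_
  obtain ⟨y, rfl⟩ := Ext.contravariant_sequence_exact₃ hS Y x (Subsingleton.elim _ _)
    (Nat.add_comm 1 n)
  rw [Subsingleton.elim y 0, Ext.comp_zero]

lemma subsingleton_ext_X₁_left (hS : S.ShortExact) {Y : C} (h₂ : Subsingleton (Ext S.X₂ Y n))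
    (h₃ : Subsingleton (Ext S.X₃ Y (n + 1))) : Subsingleton (Ext S.X₁ Y n) := by
  refine subsingleton_of_forall_eq 0 fun x => ?_
  obtain ⟨y, rfl⟩ := Ext.contravariant_sequence_exact₁ hS Y x (Nat.add_comm 1 n)
    (Subsingleton.elim _ _)
  rw [Subsingleton.elim y 0, Ext.comp_zero]

lemma subsingleton_ext_X₁_right (hS : S.ShortExact) {X : C} (h₃ : Subsingleton (Ext X S.X₃ n))
    (h₂ : Subsingleton (Ext X S.X₂ (n + 1))) : Subsingleton (Ext X S.X₁ (n + 1)) := by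
  refine subsingleton_of_forall_eq 0 fun x => ?_
  obtain ⟨y, rfl⟩ := Ext.covariant_sequence_exact₁ X hS x (Subsingleton.elim _ _) rfl
  rw [Subsingleton.elim y 0, Ext.zero_comp]

lemma subsingleton_ext_X₃_right (hS : S.ShortExact) {X : C} (h₂ : Subsingleton (Ext X S.X₂ n))
    (h₁ : Subsingleton (Ext X S.X₁ (n + 1))) : Subsingleton (Ext X S.X₃ n) := by
  refine subsingleton_of_forall_eq 0 fun x => ?_
  obtain ⟨y, rfl⟩ := Ext.covariant_sequence_exact₃ X hS x rfl (Subsingleton.elim _ _)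
  rw [Subsingleton.elim y 0, Ext.zero_comp]

lemma exists_extension (hS : S.ShortExact) {Y : C} (h : Subsingleton (Ext S.X₃ Y 1)) (φ : S.X₁ ⟶ Y) :
    ∃ ψ : S.X₂ ⟶ Y, S.f ≫ ψ = φ := by
  obtain ⟨x, hx⟩ := Ext.contravariant_sequence_exact₁ hS Y (Ext.mk₀ φ) (Nat.add_comm 1 0)
    (Subsingleton.elim _ _)
  obtain ⟨ψ, rfl⟩ := (Ext.mk₀_bijective _ _).2 x
  exact ⟨ψ, (Ext.mk₀_bijective _ _).1 (by rw [← hx, Ext.mk₀_comp_mk₀])⟩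

lemma exists_lift (hS : S.ShortExact) {X : C} (h : Subsingleton (Ext X S.X₁ 1)) (φ : X ⟶ S.X₃) :
    ∃ ψ : X ⟶ S.X₂, ψ ≫ S.g = φ := by
  obtain ⟨x, hx⟩ := Ext.covariant_sequence_exact₃ X hS (Ext.mk₀ φ) rfl
    (Subsingleton.elim _ _)
  obtain ⟨ψ, rfl⟩ := (Ext.mk₀_bijective _ _).2 x
  exact ⟨ψ, (Ext.mk₀_bijective _ _).1 (by rw [← hx, Ext.mk₀_comp_mk₀])⟩

lemma subsingleton_ext_one_of_exists_extension (hS : S.ShortExact) {Y : C} (h₂ : Subsingleton (Ext S.X₂ Y 1))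
    (h : ∀ φ : S.X₁ ⟶ Y, ∃ ψ : S.X₂ ⟶ Y, S.f ≫ ψ = φ) : Subsingleton (Ext S.X₃ Y 1) := by
  refine subsingleton_of_forall_eq 0 fun x => ?_
  obtain ⟨y, rfl⟩ := Ext.contravariant_sequence_exact₃ hS Y x (Subsingleton.elim _ _)
    (Nat.add_comm 1 0)
  obtain ⟨φ, rfl⟩ := (Ext.mk₀_bijective _ _).2 y
  obtain ⟨ψ, rfl⟩ := h φ
  rw [← Ext.mk₀_comp_mk₀, hS.extClass_comp_assoc]

lemma subsingleton_ext_one_of_exists_lift (hS : S.ShortExact) {X : C} (h₂ : Subsingleton (Ext X S.X₂ 1))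
    (h : ∀ φ : X ⟶ S.X₃, ∃ ψ : X ⟶ S.X₂, ψ ≫ S.g = φ) : Subsingleton (Ext X S.X₁ 1) := by
  refine subsingleton_of_forall_eq 0 fun x => ?_
  obtain ⟨y, rfl⟩ := Ext.covariant_sequence_exact₁ X hS x (Subsingleton.elim _ _) rfl
  obtain ⟨φ, rfl⟩ := (Ext.mk₀_bijective _ _).2 y
  obtain ⟨ψ, rfl⟩ := h φ
  rw [← Ext.mk₀_comp_mk₀, Ext.comp_assoc_of_second_deg_zero, hS.comp_extClass, Ext.comp_zero]

end CategoryTheory.ShortComplex.ShortExact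

variable [HasExt C] {n : ℕ} {M N : C}

lemma subsingleton_ext_of_retract_left (e : Retract M N) {Y : C}
    (h : Subsingleton (Ext N Y n)) : Subsingleton (Ext M Y n) := by
  refine subsingleton_of_forall_eq 0 fun x => ?_
  rw [← Ext.mk₀_id_comp x, ← e.retract, ← Ext.mk₀_comp_mk₀_assoc,
    Subsingleton.elim ((Ext.mk₀ e.r).comp x _) 0, Ext.comp_zero]

lemma subsingleton_ext_of_retract_right (e : Retract M N) {X : C}
    (h : Subsingleton (Ext X N n)) : Subsingleton (Ext X M n) := by
  refine subsingleton_of_forall_eq 0 fun x => ?_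
  rw [← Ext.comp_mk₀_id x, ← e.retract, ← Ext.mk₀_comp_mk₀,
    ← Ext.comp_assoc_of_second_deg_zero, Subsingleton.elim (x.comp (Ext.mk₀ e.i) _) 0,
    Ext.zero_comp]

end ExtVanishing

section ModuleExtensions

variable {R : Type u} [Ring R]

/-- The sequence `0 → A → B → C → 0` formed by the maps `f` and `g` is exact. -/
structure IsShortExact {A B C : ModuleCat.{u} R} (f : A →ₗ[R] B) (g : B →ₗ[R] C) : Prop where
  injective : Function.Injective f
  surjective : Function.Surjective g
  range_eq_ker : LinearMap.range f = LinearMap.ker g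

namespace IsShortExact

variable {A B C D E X Y : ModuleCat.{u} R} {f : A →ₗ[R] B} {g : B →ₗ[R] C} {n : ℕ}

lemma exact (hS : IsShortExact f g) : Function.Exact f g :=
  LinearMap.exact_iff.2 hS.range_eq_ker.symm

lemma of_exact (hf : Function.Injective f) (hg : Function.Surjective g)
    (hfg : Function.Exact f g) : IsShortExact f g :=
  ⟨hf, hg, (LinearMap.exact_iff.1 hfg).symm⟩

lemma comp_eq_zero (hS : IsShortExact f g) : g ∘ₗ f = 0 :=
  hS.exact.linearMap_comp_eq_zero

lemma shortExact (hS : IsShortExact f g) :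
    (ModuleCat.shortComplexOfCompEqZero f g hS.comp_eq_zero).ShortExact :=
  ModuleCat.shortComplex_shortExact _ hS.exact hS.injective hS.surjective

lemma extVanish_middle_left (hS : IsShortExact f g) (h₁ : extVanish R n A Y)
    (h₃ : extVanish R n C Y) : extVanish R n B Y :=
  letI := HasDerivedCategory.standard (ModuleCat.{u} R)
  letI : HasExt.{u + 1} (ModuleCat.{u} R) := hasExt_of_hasDerivedCategory _
  hS.shortExact.subsingleton_ext_X₂_left h₁ h₃

lemma extVanish_right_left (hS : IsShortExact f g) (h₁ : extVanish R n A Y)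
    (h₂ : extVanish R (n + 1) B Y) : extVanish R (n + 1) C Y :=
  letI := HasDerivedCategory.standard (ModuleCat.{u} R)
  letI : HasExt.{u + 1} (ModuleCat.{u} R) := hasExt_of_hasDerivedCategory _
  hS.shortExact.subsingleton_ext_X₃_left h₁ h₂

lemma extVanish_left_left (hS : IsShortExact f g) (h₂ : extVanish R n B Y)
    (h₃ : extVanish R (n + 1) C Y) : extVanish R n A Y :=
  letI := HasDerivedCategory.standard (ModuleCat.{u} R)
  letI : HasExt.{u + 1} (ModuleCat.{u} R) := hasExt_of_hasDerivedCategory _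
  hS.shortExact.subsingleton_ext_X₁_left h₂ h₃

lemma extVanish_left_right (hS : IsShortExact f g) (h₃ : extVanish R n X C)
    (h₂ : extVanish R (n + 1) X B) : extVanish R (n + 1) X A :=
  letI := HasDerivedCategory.standard (ModuleCat.{u} R)
  letI : HasExt.{u + 1} (ModuleCat.{u} R) := hasExt_of_hasDerivedCategory _
  hS.shortExact.subsingleton_ext_X₁_right h₃ h₂

lemma extVanish_right_right (hS : IsShortExact f g) (h₂ : extVanish R n X B)
    (h₁ : extVanish R (n + 1) X A) : extVanish R n X C :=
  letI := HasDerivedCategory.standard (ModuleCat.{u} R)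
  letI : HasExt.{u + 1} (ModuleCat.{u} R) := hasExt_of_hasDerivedCategory _
  hS.shortExact.subsingleton_ext_X₃_right h₂ h₁

lemma exists_extension (hS : IsShortExact f g) (h : extVanish R 1 C Y) (φ : A →ₗ[R] Y) :
    ∃ ψ : B →ₗ[R] Y, ψ ∘ₗ f = φ := by
  let := HasDerivedCategory.standard (ModuleCat.{u} R)
  let : HasExt.{u + 1} (ModuleCat.{u} R) := hasExt_of_hasDerivedCategory _
  obtain ⟨ψ, hψ⟩ := hS.shortExact.exists_extension h (ModuleCat.ofHom φ)
  exact ⟨ψ.hom, congrArg ModuleCat.Hom.hom hψ⟩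

lemma exists_lift (hS : IsShortExact f g) (h : extVanish R 1 X A) (φ : X →ₗ[R] C) :
    ∃ ψ : X →ₗ[R] B, g ∘ₗ ψ = φ := by
  let := HasDerivedCategory.standard (ModuleCat.{u} R)
  let : HasExt.{u + 1} (ModuleCat.{u} R) := hasExt_of_hasDerivedCategory _
  obtain ⟨ψ, hψ⟩ := hS.shortExact.exists_lift h (ModuleCat.ofHom φ)
  exact ⟨ψ.hom, congrArg ModuleCat.Hom.hom hψ⟩

lemma extVanish_one_of_exists_extension (hS : IsShortExact f g) (h₂ : extVanish R 1 B Y)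
    (h : ∀ φ : A →ₗ[R] Y, ∃ ψ : B →ₗ[R] Y, ψ ∘ₗ f = φ) : extVanish R 1 C Y :=
  letI := HasDerivedCategory.standard (ModuleCat.{u} R)
  letI : HasExt.{u + 1} (ModuleCat.{u} R) := hasExt_of_hasDerivedCategory _
  hS.shortExact.subsingleton_ext_one_of_exists_extension h₂ fun φ =>
    let ⟨ψ, hψ⟩ := h φ.hom
    ⟨ModuleCat.ofHom ψ, ModuleCat.hom_ext hψ⟩

lemma extVanish_one_of_exists_lift (hS : IsShortExact f g) (h₂ : extVanish R 1 X B)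
    (h : ∀ φ : X →ₗ[R] C, ∃ ψ : X →ₗ[R] B, g ∘ₗ ψ = φ) : extVanish R 1 X A :=
  letI := HasDerivedCategory.standard (ModuleCat.{u} R)
  letI : HasExt.{u + 1} (ModuleCat.{u} R) := hasExt_of_hasDerivedCategory _
  hS.shortExact.subsingleton_ext_one_of_exists_lift h₂ fun φ =>
    let ⟨ψ, hψ⟩ := h φ.hom
    ⟨ModuleCat.ofHom ψ, ModuleCat.hom_ext hψ⟩

/-- A map killing `A` factors through `B → C`. -/
lemma exists_factor (hS : IsShortExact f g) (φ : B →ₗ[R] Y) (hφ : φ ∘ₗ f = 0) :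
    ∃ ψ : C →ₗ[R] Y, ψ ∘ₗ g = φ := by
  have hk : LinearMap.ker g ≤ LinearMap.ker φ := by
    rw [← hS.range_eq_ker]
    exact LinearMap.range_le_ker_iff.2 hφ
  refine ⟨(LinearMap.ker g).liftQ φ hk ∘ₗ
    (g.quotKerEquivOfSurjective hS.surjective).symm.toLinearMap, ?_⟩
  ext b
  have : (g.quotKerEquivOfSurjective hS.surjective).symm (g b) = Submodule.Quotient.mk b := by
    rw [LinearEquiv.symm_apply_eq]; rfl
  simp [this]

/-- A map into `B` killed by `B → C` factors through `A → B`. -/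
lemma exists_factor_left (hS : IsShortExact f g) (φ : X →ₗ[R] B) (hφ : g ∘ₗ φ = 0) :
    ∃ ψ : X →ₗ[R] A, f ∘ₗ ψ = φ := by
  have hk : ∀ x, φ x ∈ LinearMap.range f := fun x => by
    rw [hS.range_eq_ker]
    exact LinearMap.congr_fun hφ x
  refine ⟨(LinearEquiv.ofInjective f hS.injective).symm.toLinearMap ∘ₗ φ.codRestrict _ hk, ?_⟩
  ext x
  exact congrArg Subtype.val
    ((LinearEquiv.ofInjective f hS.injective).apply_symm_apply (φ.codRestrict _ hk x))

variable (f) in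
lemma mkQ_range (hf : Function.Injective f) :
    IsShortExact (C := ModuleCat.of R (B ⧸ LinearMap.range f)) f (LinearMap.range f).mkQ :=
  ⟨hf, Submodule.mkQ_surjective _, (Submodule.ker_mkQ _).symm⟩

variable (g) in
lemma ker_subtype (hg : Function.Surjective g) :
    IsShortExact (A := ModuleCat.of R (LinearMap.ker g)) (LinearMap.ker g).subtype g :=
  ⟨Subtype.val_injective, hg, Submodule.range_subtype _⟩

/-- The cokernels of two composable injections and of their composition form a short exact
sequence. -/
lemma exists_comp {h : B →ₗ[R] D} {k : D →ₗ[R] E} (hS : IsShortExact f g)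
    (hT : IsShortExact h k) :
    ∃ (F : ModuleCat.{u} R) (p : D →ₗ[R] F) (i : C →ₗ[R] F) (q : F →ₗ[R] E),
      IsShortExact (h ∘ₗ f) p ∧ IsShortExact i q := by
  have hU := mkQ_range (h ∘ₗ f) (hT.injective.comp hS.injective)
  set p := (LinearMap.range (h ∘ₗ f)).mkQ
  obtain ⟨i, hi⟩ := hS.exists_factor (Y := ModuleCat.of R (D ⧸ LinearMap.range (h ∘ₗ f))) (p ∘ₗ h)
    hU.comp_eq_zero
  obtain ⟨q, hq⟩ := hU.exists_factor k (by rw [← LinearMap.comp_assoc, hT.comp_eq_zero]; rfl)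
  have hi' : ∀ b, i (g b) = p (h b) := LinearMap.congr_fun hi
  have hq' : ∀ d, q (p d) = k d := LinearMap.congr_fun hq
  refine ⟨_, p, i, q, hU, of_exact ?_ ?_ ?_⟩
  · rw [injective_iff_map_eq_zero]
    intro c hc
    obtain ⟨b, rfl⟩ := hS.surjective c
    rw [hi'] at hc
    obtain ⟨a, ha⟩ := (hU.exact _).1 hc
    rw [← hT.injective ha]
    exact hS.exact.apply_apply_eq_zero a
  · intro e
    obtain ⟨d, rfl⟩ := hT.surjective e
    exact ⟨p d, hq' d⟩
  · intro x
    obtain ⟨d, rfl⟩ := hU.surjective x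
    rw [hq']
    constructor
    · intro hd
      obtain ⟨b, rfl⟩ := (hT.exact _).1 hd
      exact ⟨g b, hi' b⟩
    · rintro ⟨c, hc⟩
      obtain ⟨b, rfl⟩ := hS.surjective c
      rw [← hq', ← hc, hi', hq']
      exact hT.exact.apply_apply_eq_zero b

/-- Horseshoe lemma for one step of a coresolution. -/
lemma exists_horseshoe_right {J A₁ I C₁ : ModuleCat.{u} R} {j : A →ₗ[R] J} {p : J →ₗ[R] A₁}
    {i : C →ₗ[R] I} {q : I →ₗ[R] C₁} (hS : IsShortExact f g) (hA : IsShortExact j p)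
    (hC : IsShortExact i q) (φ : B →ₗ[R] J) (hφ : φ ∘ₗ f = j) :
    ∃ (B₁ : ModuleCat.{u} R) (k : B →ₗ[R] ModuleCat.of R (J × I))
      (r : ModuleCat.of R (J × I) →ₗ[R] B₁) (f₁ : A₁ →ₗ[R] B₁) (g₁ : B₁ →ₗ[R] C₁),
      IsShortExact k r ∧ IsShortExact f₁ g₁ := by
  have hφ' : ∀ a, φ (f a) = j a := LinearMap.congr_fun hφ
  have hgf := hS.exact.apply_apply_eq_zero
  let k : B →ₗ[R] ModuleCat.of R (J × I) := φ.prod (i ∘ₗ g)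
  have hk : Function.Injective k := by
    rw [injective_iff_map_eq_zero]
    intro b hb
    obtain ⟨h1, h2⟩ := Prod.mk.inj hb
    obtain ⟨a, rfl⟩ := (hS.exact b).1 ((injective_iff_map_eq_zero i).1 hC.injective _ h2)
    rw [(injective_iff_map_eq_zero j).1 hA.injective a ((hφ' a).symm.trans h1), map_zero]
  have hU := mkQ_range k hk
  set r := (LinearMap.range k).mkQ
  obtain ⟨f₁, hf₁⟩ := hA.exists_factor (Y := ModuleCat.of R (_ ⧸ LinearMap.range k))
    (r ∘ₗ LinearMap.inl R J I) (by
      ext a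
      refine (hU.exact _).2 ⟨f a, ?_⟩
      simp [k, hφ', hgf])
  obtain ⟨g₁, hg₁⟩ := hU.exists_factor (Y := C₁) (q ∘ₗ LinearMap.snd R J I) (by
      ext b
      exact hC.exact.apply_apply_eq_zero (g b))
  have hf' : ∀ x, f₁ (p x) = r (x, 0) := LinearMap.congr_fun hf₁
  have hg' : ∀ x, g₁ (r x) = q x.2 := LinearMap.congr_fun hg₁
  refine ⟨_, k, r, f₁, g₁, hU, of_exact ?_ ?_ ?_⟩
  · rw [injective_iff_map_eq_zero]
    intro x hx
    obtain ⟨x, rfl⟩ := hA.surjective x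
    rw [hf'] at hx
    obtain ⟨b, hb⟩ := (hU.exact _).1 hx
    obtain ⟨h1, h2⟩ := Prod.mk.inj hb
    obtain ⟨a, rfl⟩ := (hS.exact b).1 ((injective_iff_map_eq_zero i).1 hC.injective _ h2)
    rw [← h1]
    exact (congrArg p (hφ' a)).trans (hA.exact.apply_apply_eq_zero a)
  · intro c
    obtain ⟨y, rfl⟩ := hC.surjective c
    exact ⟨r (0, y), hg' _⟩
  · intro x
    obtain ⟨⟨x, y⟩, rfl⟩ := hU.surjective x
    rw [hg']
    constructor
    · intro hy
      obtain ⟨c, rfl⟩ := (hC.exact y).1 hy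
      obtain ⟨b, rfl⟩ := hS.surjective c
      refine ⟨p (x - φ b), ?_⟩
      rw [hf', ← sub_eq_zero, ← map_sub]
      exact (hU.exact _).2 ⟨-b, by simp [k]⟩
    · rintro ⟨z, hz⟩
      obtain ⟨z, rfl⟩ := hA.surjective z
      rw [← hg', ← hz, hf', hg']
      exact map_zero q

/-- Horseshoe lemma for one step of a resolution. -/
lemma exists_horseshoe_left {P A₁ Q C₁ : ModuleCat.{u} R} {j : A₁ →ₗ[R] P} {p : P →ₗ[R] A}
    {i : C₁ →ₗ[R] Q} {q : Q →ₗ[R] C} (hS : IsShortExact f g) (hA : IsShortExact j p)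
    (hC : IsShortExact i q) (φ : Q →ₗ[R] B) (hφ : g ∘ₗ φ = q) :
    ∃ (B₁ : ModuleCat.{u} R) (k : B₁ →ₗ[R] ModuleCat.of R (P × Q))
      (r : ModuleCat.of R (P × Q) →ₗ[R] B) (f₁ : A₁ →ₗ[R] B₁) (g₁ : B₁ →ₗ[R] C₁),
      IsShortExact k r ∧ IsShortExact f₁ g₁ := by
  have hφ' : ∀ a, g (φ a) = q a := LinearMap.congr_fun hφ
  have hgf := hS.exact.apply_apply_eq_zero
  let r : ModuleCat.of R (P × Q) →ₗ[R] B := (f ∘ₗ p).coprod φ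
  have hr' : ∀ x y, r (x, y) = f (p x) + φ y := fun x y => LinearMap.coprod_apply _ _ _
  have hr : Function.Surjective r := by
    intro b
    obtain ⟨y, hy⟩ := hC.surjective (g b)
    obtain ⟨a, ha⟩ := (hS.exact (b - φ y)).1 (by rw [map_sub, hφ', hy, sub_self])
    obtain ⟨x, rfl⟩ := hA.surjective a
    exact ⟨(x, y), by rw [hr', ha, sub_add_cancel]⟩
  have hU := ker_subtype r hr
  set k := (LinearMap.ker r).subtype
  have hrk := hU.exact.apply_apply_eq_zero
  obtain ⟨f₁, hf₁⟩ := hU.exists_factor_left (X := A₁) (LinearMap.inl R P Q ∘ₗ j) (by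
      refine LinearMap.ext fun a => (hr' (j a) 0).trans ?_
      rw [hA.exact.apply_apply_eq_zero, map_zero, map_zero, add_zero]; rfl)
  have hqk : ∀ b, q (k b).2 = 0 := fun b => by
    have := congrArg g (hrk b)
    rw [← Prod.mk.eta (p := k b), hr', map_add, hgf, hφ', zero_add, map_zero] at this
    exact this
  obtain ⟨g₁, hg₁⟩ := hC.exists_factor_left
    (X := ModuleCat.of R (LinearMap.ker r)) (LinearMap.snd R P Q ∘ₗ k) (by
      ext b
      exact hqk b)
  have hf' : ∀ x, k (f₁ x) = (j x, 0) := LinearMap.congr_fun hf₁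
  have hg' : ∀ x, i (g₁ x) = (k x).2 := LinearMap.congr_fun hg₁
  refine ⟨_, k, r, f₁, g₁, hU, of_exact ?_ ?_ ?_⟩
  · rw [injective_iff_map_eq_zero]
    intro x hx
    have := (hf' x).symm.trans ((congrArg k hx).trans (map_zero k))
    exact (injective_iff_map_eq_zero j).1 hA.injective x (Prod.mk.inj this).1
  · intro c
    have hc := hC.exact.apply_apply_eq_zero c
    obtain ⟨a, ha⟩ := (hS.exact (φ (i c))).1 (by rw [hφ', hc])
    obtain ⟨x, rfl⟩ := hA.surjective a
    obtain ⟨b, hb⟩ := (hU.exact (-x, i c)).1 (by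
      rw [hr', map_neg, map_neg, ha, neg_add_cancel])
    exact ⟨b, hC.injective (by rw [hg', hb])⟩
  · intro b
    constructor
    · intro hb
      have h2 : (k b).2 = 0 := by rw [← hg', hb, map_zero]
      have h1 : p (k b).1 = 0 := by
        have := hrk b
        rw [← Prod.mk.eta (p := k b), hr', h2, map_zero, add_zero] at this
        exact (injective_iff_map_eq_zero f).1 hS.injective _ this
      obtain ⟨a, ha⟩ := (hA.exact _).1 h1
      exact ⟨a, hU.injective (by rw [hf', ha, ← h2])⟩
    · rintro ⟨a, rfl⟩
      apply hC.injective
      rw [hg', hf', map_zero]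

end IsShortExact

lemma extVanish_of_projective {P : ModuleCat.{u} R} (hP : Module.Projective R P) (n : ℕ)
    (Y : ModuleCat.{u} R) : extVanish R (n + 1) P Y :=
  letI := HasDerivedCategory.standard (ModuleCat.{u} R)
  letI : HasExt.{u + 1} (ModuleCat.{u} R) := hasExt_of_hasDerivedCategory _
  haveI : Projective P := (IsProjective.iff_projective (R := R) P).1 hP
  Abelian.Ext.subsingleton_of_projective P Y n

lemma extVanish_of_injective {I : ModuleCat.{u} R} (hI : Module.Injective R I) (n : ℕ)
    (X : ModuleCat.{u} R) : extVanish R (n + 1) X I :=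
  letI := HasDerivedCategory.standard (ModuleCat.{u} R)
  letI : HasExt.{u + 1} (ModuleCat.{u} R) := hasExt_of_hasDerivedCategory _
  haveI : Injective I := (Module.injective_iff_injective_object R I).1 hI
  Abelian.Ext.subsingleton_of_injective X I n

lemma extVanish_of_retract_left {n : ℕ} {M N : ModuleCat.{u} R} {i : M →ₗ[R] N} {r : N →ₗ[R] M}
    (h : r ∘ₗ i = LinearMap.id) {Y : ModuleCat.{u} R} (hN : extVanish R n N Y) :
    extVanish R n M Y :=
  letI := HasDerivedCategory.standard (ModuleCat.{u} R)
  letI : HasExt.{u + 1} (ModuleCat.{u} R) := hasExt_of_hasDerivedCategory _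
  subsingleton_ext_of_retract_left
    ⟨ModuleCat.ofHom i, ModuleCat.ofHom r, ModuleCat.hom_ext h⟩ hN

lemma extVanish_of_retract_right {n : ℕ} {M N : ModuleCat.{u} R} {i : M →ₗ[R] N} {r : N →ₗ[R] M}
    (h : r ∘ₗ i = LinearMap.id) {X : ModuleCat.{u} R} (hN : extVanish R n X N) :
    extVanish R n X M :=
  letI := HasDerivedCategory.standard (ModuleCat.{u} R)
  letI : HasExt.{u + 1} (ModuleCat.{u} R) := hasExt_of_hasDerivedCategory _
  subsingleton_ext_of_retract_right
    ⟨ModuleCat.ofHom i, ModuleCat.ofHom r, ModuleCat.hom_ext h⟩ hN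

/-- There is a short exact sequence `0 → A → P → B → 0` with `P` projective. -/
def IsProjectiveStep (A B : ModuleCat.{u} R) : Prop :=
  ∃ (P : ModuleCat.{u} R) (f : A →ₗ[R] P) (g : P →ₗ[R] B),
    Module.Projective R P ∧ IsShortExact f g

/-- There is a short exact sequence `0 → A → I → B → 0` with `I` injective. -/
def IsInjectiveStep (A B : ModuleCat.{u} R) : Prop :=
  ∃ (I : ModuleCat.{u} R) (f : A →ₗ[R] I) (g : I →ₗ[R] B),
    Module.Injective R I ∧ IsShortExact f g

lemma exists_isProjectiveStep (M : ModuleCat.{u} R) : ∃ K, IsProjectiveStep K M :=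
  ⟨_, ModuleCat.of R (M →₀ R), _, Finsupp.linearCombination R id,
    inferInstanceAs (Module.Projective R (M →₀ R)),
    IsShortExact.ker_subtype _ (Finsupp.linearCombination_id_surjective R M)⟩

lemma exists_isInjectiveStep (M : ModuleCat.{u} R) : ∃ C, IsInjectiveStep M C :=
  ⟨_, Injective.under M, (Injective.ι M).hom, _,
    (Module.injective_iff_injective_object R _).2 (Injective.injective_under M),
    IsShortExact.mkQ_range _ ((ModuleCat.mono_iff_injective (Injective.ι M)).1 inferInstance)⟩

lemma projective_of_extVanish {P : ModuleCat.{u} R} (h : ∀ Y, extVanish R 1 P Y) :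
    Module.Projective R P := by
  obtain ⟨K, Q, f, g, hQ, hS⟩ := exists_isProjectiveStep P
  obtain ⟨s, hs⟩ := hS.exists_lift (h K) LinearMap.id
  exact Module.Projective.of_split s g hs

lemma injective_of_extVanish {I : ModuleCat.{u} R} (h : ∀ X, extVanish R 1 X I) :
    Module.Injective R I where
  out X Y _ _ _ _ f hf φ := by
    obtain ⟨ψ, hψ⟩ := (IsShortExact.mkQ_range (A := ModuleCat.of R X) (B := ModuleCat.of R Y)
      f hf).exists_extension (h _) φ
    exact ⟨ψ, LinearMap.congr_fun hψ⟩

lemma injective_prod {I J : ModuleCat.{u} R} (hI : Module.Injective R I)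
    (hJ : Module.Injective R J) : Module.Injective R (ModuleCat.of R (I × J)) where
  out X Y _ _ _ _ f hf φ := by
    obtain ⟨ψ₁, h₁⟩ := hI.out f hf (LinearMap.fst R I J ∘ₗ φ)
    obtain ⟨ψ₂, h₂⟩ := hJ.out f hf (LinearMap.snd R I J ∘ₗ φ)
    exact ⟨ψ₁.prod ψ₂, fun x => Prod.ext (h₁ x) (h₂ x)⟩

lemma injDimLE_of_extVanish {n : ℕ} {M : ModuleCat.{u} R}
    (h : ∀ X, extVanish R (n + 1) X M) : injDimLE R n M := by
  induction n generalizing M with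
  | zero => exact injective_of_extVanish h
  | succ n ih =>
    obtain ⟨C, I, f, g, hI, hS⟩ := exists_isInjectiveStep M
    exact ⟨I, C, f, g, hI, hS.injective, hS.surjective, hS.range_eq_ker,
      ih fun X => hS.extVanish_right_right (extVanish_of_injective hI _ X) (h X)⟩

lemma projDimLE_of_extVanish {n : ℕ} {M : ModuleCat.{u} R}
    (h : ∀ Y, extVanish R (n + 1) M Y) : projDimLE R n M := by
  induction n generalizing M with
  | zero => exact projective_of_extVanish h
  | succ n ih =>
    obtain ⟨K, P, f, g, hP, hS⟩ := exists_isProjectiveStep M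
    exact ⟨K, P, f, g, hP, hS.injective, hS.surjective, hS.range_eq_ker,
      ih fun Y => hS.extVanish_left_left (extVanish_of_projective hP _ Y) (h Y)⟩

end ModuleExtensions

section CompleteResolutions

variable {R : Type u} [Ring R]

lemma exists_int_sequence {α : Type*} {S : α → α → Prop} (hr : ∀ a, ∃ b, S a b)
    (hl : ∀ b, ∃ a, S a b) (a : α) : ∃ Y : ℤ → α, Y (0 + 1) = a ∧ ∀ i, S (Y i) (Y (i + 1)) := by
  choose r hr using hr
  choose l hl using hl
  let Z : ℤ → α := fun
    | Int.ofNat n => r^[n] a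
    | Int.negSucc n => l^[n + 1] a
  have hZ : ∀ i, S (Z i) (Z (i + 1)) := by
    rintro (n | _ | n)
    · change S (r^[n] a) (r^[n + 1] a)
      rw [Function.iterate_succ_apply']
      exact hr _
    · exact hl a
    · change S (l^[n + 1 + 1] a) (l^[n + 1] a)
      rw [Function.iterate_succ_apply' l (n + 1)]
      exact hl _
  refine ⟨fun i => Z (i - 1), rfl, fun i => ?_⟩
  have := hZ (i - 1)
  rwa [show i - 1 + 1 = i + 1 - 1 by ring] at this

/-- Two consecutive maps of an exact complex yield a short exact sequence of images. -/
lemma isShortExact_range {A B C X Y : ModuleCat.{u} R} {a : A →ₗ[R] B} {b : B →ₗ[R] C}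
    (h : LinearMap.range a = LinearMap.ker b) (e₁ : X ≃ₗ[R] LinearMap.range a)
    (e₂ : Y ≃ₗ[R] LinearMap.range b) :
    IsShortExact ((LinearMap.range a).subtype ∘ₗ e₁.toLinearMap)
      (e₂.symm.toLinearMap ∘ₗ b.rangeRestrict) where
  injective := Subtype.val_injective.comp e₁.injective
  surjective := e₂.symm.surjective.comp b.surjective_rangeRestrict
  range_eq_ker := by
    rw [LinearMap.range_comp, LinearEquiv.range, Submodule.map_top, Submodule.range_subtype,
      LinearEquiv.ker_comp, LinearMap.ker_rangeRestrict, h]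

/-- A class of modules closed under syzygies and cosyzygies along projective modules, and left
orthogonal to projective modules. -/
structure IsGorensteinProjectiveClass (E : ModuleCat.{u} R → Prop) : Prop where
  extVanish_projective : ∀ {X}, E X → ∀ {Q : ModuleCat.{u} R}, Module.Projective R Q → extVanish R 1 X Q
  exists_cosyzygy : ∀ {X}, E X → ∃ Y, E Y ∧ IsProjectiveStep X Y
  exists_syzygy : ∀ {X}, E X → ∃ Y, E Y ∧ IsProjectiveStep Y X

/-- A class of modules closed under syzygies and cosyzygies along injective modules, and right
orthogonal to injective modules. -/
structure IsGorensteinInjectiveClass (E : ModuleCat.{u} R → Prop) : Prop where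
  injective_extVanish : ∀ {X}, E X → ∀ {I : ModuleCat.{u} R}, Module.Injective R I → extVanish R 1 I X
  exists_cosyzygy : ∀ {X}, E X → ∃ Y, E Y ∧ IsInjectiveStep X Y
  exists_syzygy : ∀ {X}, E X → ∃ Y, E Y ∧ IsInjectiveStep Y X

lemma IsGorensteinProjectiveClass.isGorensteinProjective {E : ModuleCat.{u} R → Prop}
    (hE : IsGorensteinProjectiveClass E) {G : ModuleCat.{u} R} (hG : E G) :
    IsGorensteinProjective R G := by
  obtain ⟨Y, hY, hS⟩ := exists_int_sequence (α := {X // E X})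
    (S := fun A B => IsProjectiveStep A.1 B.1)
    (fun A => let ⟨B, hB, h⟩ := hE.exists_cosyzygy A.2; ⟨⟨B, hB⟩, h⟩)
    (fun A => let ⟨B, hB, h⟩ := hE.exists_syzygy A.2; ⟨⟨B, hB⟩, h⟩) ⟨G, hG⟩
  obtain rfl : (Y (0 + 1)).1 = G := congrArg Subtype.val hY
  choose P f g hP hS using hS
  refine ⟨P, fun i => f (i + 1) ∘ₗ g i, hP, fun i => ?_, ⟨?_⟩, fun Q hQ i φ hφ => ?_⟩
  · rw [LinearMap.range_comp_of_range_eq_top _ (LinearMap.range_eq_top.2 (hS i).surjective),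
      LinearMap.ker_comp_of_ker_eq_bot _ (LinearMap.ker_eq_bot.2 (hS _).injective),
      (hS _).range_eq_ker]
  · rw [LinearMap.range_comp_of_range_eq_top _ (LinearMap.range_eq_top.2 (hS 0).surjective)]
    exact LinearEquiv.ofInjective (f (0 + 1)) (hS (0 + 1)).injective
  · obtain ⟨ψ, hψ⟩ := (hS (i + 1)).exists_factor φ (by
      rwa [← LinearMap.comp_assoc, ← LinearMap.zero_comp (g i),
        LinearMap.cancel_right (hS i).surjective] at hφ)
    obtain ⟨χ, hχ⟩ := (hS (i + 1 + 1)).exists_extension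
      (hE.extVanish_projective (Y (i + 1 + 1 + 1)).2 hQ) ψ
    exact ⟨χ, by rw [← LinearMap.comp_assoc, hχ, hψ]⟩

lemma IsGorensteinInjectiveClass.isGorensteinInjective {E : ModuleCat.{u} R → Prop}
    (hE : IsGorensteinInjectiveClass E) {G : ModuleCat.{u} R} (hG : E G) :
    IsGorensteinInjective R G := by
  obtain ⟨Y, hY, hS⟩ := exists_int_sequence (α := {X // E X})
    (S := fun A B => IsInjectiveStep A.1 B.1)
    (fun A => let ⟨B, hB, h⟩ := hE.exists_cosyzygy A.2; ⟨⟨B, hB⟩, h⟩)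
    (fun A => let ⟨B, hB, h⟩ := hE.exists_syzygy A.2; ⟨⟨B, hB⟩, h⟩) ⟨G, hG⟩
  obtain rfl : (Y (0 + 1)).1 = G := congrArg Subtype.val hY
  choose I f g hI hS using hS
  refine ⟨I, fun i => f (i + 1) ∘ₗ g i, hI, fun i => ?_, ⟨?_⟩, fun J hJ i φ hφ => ?_⟩
  · rw [LinearMap.range_comp_of_range_eq_top _ (LinearMap.range_eq_top.2 (hS i).surjective),
      LinearMap.ker_comp_of_ker_eq_bot _ (LinearMap.ker_eq_bot.2 (hS _).injective),
      (hS _).range_eq_ker]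
  · rw [LinearMap.range_comp_of_range_eq_top _ (LinearMap.range_eq_top.2 (hS 0).surjective)]
    exact LinearEquiv.ofInjective (f (0 + 1)) (hS (0 + 1)).injective
  · obtain ⟨ψ, hψ⟩ := (hS (i + 1)).exists_factor_left φ (by
      rw [← LinearMap.cancel_left (hS (i + 1 + 1)).injective, LinearMap.comp_zero]
      exact hφ)
    obtain ⟨χ, hχ⟩ := (hS i).exists_lift (hE.injective_extVanish (Y i).2 hJ) ψ
    exact ⟨χ, by rw [LinearMap.comp_assoc, hχ, hψ]⟩

lemma isGorensteinProjectiveClass :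
    IsGorensteinProjectiveClass (IsGorensteinProjective R) := by
  suffices h : ∀ G : ModuleCat.{u} R, IsGorensteinProjective R G →
      ∃ E, IsGorensteinProjectiveClass E ∧ E G from
    { extVanish_projective := fun hX _ hQ =>
        let ⟨_, hE, hEX⟩ := h _ hX
        hE.extVanish_projective hEX hQ
      exists_cosyzygy := fun hX =>
        let ⟨_, hE, hEX⟩ := h _ hX
        let ⟨Y, hY, hXY⟩ := hE.exists_cosyzygy hEX
        ⟨Y, hE.isGorensteinProjective hY, hXY⟩
      exists_syzygy := fun hX =>
        let ⟨_, hE, hEX⟩ := h _ hX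
        let ⟨Y, hY, hXY⟩ := hE.exists_syzygy hEX
        ⟨Y, hE.isGorensteinProjective hY, hXY⟩ }
  rintro G ⟨P, d, hP, hd, hG, htot⟩
  refine ⟨fun X => ∃ i, Nonempty (X ≃ₗ[R] LinearMap.range (d i)), ⟨?_, ?_, ?_⟩, 0, hG⟩
  · rintro X ⟨i, ⟨e⟩⟩ Q hQ
    obtain ⟨i, rfl⟩ : ∃ j, i = j + 1 + 1 := ⟨i - 1 - 1, by omega⟩
    refine (isShortExact_range (X := ModuleCat.of R (LinearMap.range (d (i + 1)))) (hd (i + 1))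
      (LinearEquiv.refl R _) e).extVanish_one_of_exists_extension
      (extVanish_of_projective (hP _) 0 Q) fun φ => ?_
    obtain ⟨ψ, hψ⟩ := htot Q hQ i (φ ∘ₗ (d (i + 1)).rangeRestrict) (by
      ext x
      have : (d (i + 1)).rangeRestrict (d i x) = 0 :=
        Subtype.ext ((hd i).le ⟨x, rfl⟩)
      exact (congrArg φ this).trans (map_zero φ))
    refine ⟨ψ, ?_⟩
    rw [← LinearMap.cancel_right (d (i + 1)).surjective_rangeRestrict]
    exact hψ
  · rintro X ⟨i, ⟨e⟩⟩
    exact ⟨ModuleCat.of R (LinearMap.range (d (i + 1))), ⟨i + 1, ⟨LinearEquiv.refl R _⟩⟩,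
      P (i + 1), _, _, hP _, isShortExact_range (hd i) e (LinearEquiv.refl R _)⟩
  · rintro X ⟨i, ⟨e⟩⟩
    obtain ⟨i, rfl⟩ : ∃ j, i = j + 1 := ⟨i - 1, by omega⟩
    exact ⟨ModuleCat.of R (LinearMap.range (d i)), ⟨i, ⟨LinearEquiv.refl R _⟩⟩,
      P (i + 1), _, _, hP _, isShortExact_range (hd i) (LinearEquiv.refl R _) e⟩

lemma isGorensteinInjectiveClass :
    IsGorensteinInjectiveClass (IsGorensteinInjective R) := by
  suffices h : ∀ G : ModuleCat.{u} R, IsGorensteinInjective R G →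
      ∃ E, IsGorensteinInjectiveClass E ∧ E G from
    { injective_extVanish := fun hX _ hQ =>
        let ⟨_, hE, hEX⟩ := h _ hX
        hE.injective_extVanish hEX hQ
      exists_cosyzygy := fun hX =>
        let ⟨_, hE, hEX⟩ := h _ hX
        let ⟨Y, hY, hXY⟩ := hE.exists_cosyzygy hEX
        ⟨Y, hE.isGorensteinInjective hY, hXY⟩
      exists_syzygy := fun hX =>
        let ⟨_, hE, hEX⟩ := h _ hX
        let ⟨Y, hY, hXY⟩ := hE.exists_syzygy hEX
        ⟨Y, hE.isGorensteinInjective hY, hXY⟩ }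
  rintro G ⟨I, d, hI, hd, hG, htot⟩
  refine ⟨fun X => ∃ i, Nonempty (X ≃ₗ[R] LinearMap.range (d i)), ⟨?_, ?_, ?_⟩, 0, hG⟩
  · rintro X ⟨i, ⟨e⟩⟩ J hJ
    refine (isShortExact_range (Y := ModuleCat.of R (LinearMap.range (d (i + 1)))) (hd i)
      e (LinearEquiv.refl R _)).extVanish_one_of_exists_lift
      (extVanish_of_injective (hI _) 0 J) fun φ => ?_
    obtain ⟨ψ, hψ⟩ := htot J hJ (i + 1) ((LinearMap.range (d (i + 1))).subtype ∘ₗ φ) (by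
      ext x
      exact (hd (i + 1)).le (φ x).2)
    refine ⟨ψ, ?_⟩
    rw [← LinearMap.cancel_left (LinearMap.range (d (i + 1))).injective_subtype]
    exact hψ
  · rintro X ⟨i, ⟨e⟩⟩
    exact ⟨ModuleCat.of R (LinearMap.range (d (i + 1))), ⟨i + 1, ⟨LinearEquiv.refl R _⟩⟩,
      I (i + 1), _, _, hI _, isShortExact_range (hd i) e (LinearEquiv.refl R _)⟩
  · rintro X ⟨i, ⟨e⟩⟩
    obtain ⟨i, rfl⟩ : ∃ j, i = j + 1 := ⟨i - 1, by omega⟩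
    exact ⟨ModuleCat.of R (LinearMap.range (d i)), ⟨i, ⟨LinearEquiv.refl R _⟩⟩,
      I (i + 1), _, _, hI _, isShortExact_range (hd i) (LinearEquiv.refl R _) e⟩

end CompleteResolutions

section FiniteGorensteinDimension

variable {R : Type u} [Ring R]

lemma IsGorensteinProjective.extVanish_projective {G Q : ModuleCat.{u} R}
    (hG : IsGorensteinProjective R G) (hQ : Module.Projective R Q) (n : ℕ) :
    extVanish R (n + 1) G Q := by
  induction n generalizing G with
  | zero => exact isGorensteinProjectiveClass.extVanish_projective hG hQ
  | succ n ih =>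
    obtain ⟨K, hK, P, f, g, hP, hS⟩ := isGorensteinProjectiveClass.exists_syzygy hG
    exact hS.extVanish_right_left (ih hK) (extVanish_of_projective hP _ Q)

lemma IsGorensteinInjective.injective_extVanish {G I : ModuleCat.{u} R}
    (hG : IsGorensteinInjective R G) (hI : Module.Injective R I) (n : ℕ) :
    extVanish R (n + 1) I G := by
  induction n generalizing G with
  | zero => exact isGorensteinInjectiveClass.injective_extVanish hG hI
  | succ n ih =>
    obtain ⟨C, hC, J, f, g, hJ, hS⟩ := isGorensteinInjectiveClass.exists_cosyzygy hG
    exact hS.extVanish_left_right (ih hC) (extVanish_of_injective hJ _ I)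

lemma IsGorensteinProjective.extVanish_of_projDimLE {G M : ModuleCat.{u} R} {n : ℕ}
    (hG : IsGorensteinProjective R G) (hM : projDimLE R n M) (k : ℕ) :
    extVanish R (k + 1) G M := by
  induction n generalizing M k with
  | zero => exact hG.extVanish_projective hM k
  | succ n ih =>
    obtain ⟨K, P, f, g, hP, hf, hg, hfg, hK⟩ := hM
    exact (IsShortExact.mk hf hg hfg).extVanish_right_right (hG.extVanish_projective hP k)
      (ih hK (k + 1))

lemma IsGorensteinInjective.extVanish_of_injDimLE {G M : ModuleCat.{u} R} {n : ℕ}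
    (hG : IsGorensteinInjective R G) (hM : injDimLE R n M) (k : ℕ) :
    extVanish R (k + 1) M G := by
  induction n generalizing M k with
  | zero => exact hG.injective_extVanish hM k
  | succ n ih =>
    obtain ⟨I, C, f, g, hI, hf, hg, hfg, hC⟩ := hM
    exact (IsShortExact.mk hf hg hfg).extVanish_left_left (hG.injective_extVanish hI k)
      (ih hC (k + 1))

lemma extVanish_of_gpdLE {M Q : ModuleCat.{u} R} {n : ℕ} (hM : gpdLE R n M)
    (hQ : Module.Projective R Q) (k : ℕ) : extVanish R (n + k + 1) M Q := by
  induction n generalizing M with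
  | zero => exact IsGorensteinProjective.extVanish_projective hM hQ _
  | succ n ih =>
    obtain ⟨K, G, f, g, hG, hf, hg, hfg, hK⟩ := hM
    rw [show n + 1 + k + 1 = n + k + 1 + 1 by omega]
    exact (IsShortExact.mk hf hg hfg).extVanish_right_left (ih hK)
      (hG.extVanish_projective hQ _)

lemma projective_prod {P Q : ModuleCat.{u} R} (hP : Module.Projective R P)
    (hQ : Module.Projective R Q) : Module.Projective R (ModuleCat.of R (P × Q)) :=
  inferInstanceAs (Module.Projective R (P × Q))

/-- Gorenstein projective modules are closed under extensions. -/
lemma IsShortExact.isGorensteinProjective {A B C : ModuleCat.{u} R} {f : A →ₗ[R] B}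
    {g : B →ₗ[R] C} (hS : IsShortExact f g) (hA : IsGorensteinProjective R A)
    (hC : IsGorensteinProjective R C) : IsGorensteinProjective R B := by
  have hGP := isGorensteinProjectiveClass (R := R)
  refine IsGorensteinProjectiveClass.isGorensteinProjective
    (E := fun B => ∃ (A C : ModuleCat.{u} R) (f : A →ₗ[R] B) (g : B →ₗ[R] C),
      IsGorensteinProjective R A ∧ IsGorensteinProjective R C ∧ IsShortExact f g)
    ⟨?_, ?_, ?_⟩ ⟨A, C, f, g, hA, hC, hS⟩
  · rintro X ⟨A, C, f, g, hA, hC, hS⟩ Q hQ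
    exact hS.extVanish_middle_left (hGP.extVanish_projective hA hQ)
      (hGP.extVanish_projective hC hQ)
  · rintro X ⟨A, C, f, g, hA, hC, hS⟩
    obtain ⟨A₁, hA₁, P, j, p, hP, hSA⟩ := hGP.exists_cosyzygy hA
    obtain ⟨C₁, hC₁, Q, i, q, hQ, hSC⟩ := hGP.exists_cosyzygy hC
    obtain ⟨φ, hφ⟩ := hS.exists_extension (hGP.extVanish_projective hC hP) j
    obtain ⟨B₁, k, r, f₁, g₁, hU, hT⟩ := hS.exists_horseshoe_right hSA hSC φ hφ
    exact ⟨B₁, ⟨A₁, C₁, f₁, g₁, hA₁, hC₁, hT⟩, _, k, r, projective_prod hP hQ, hU⟩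
  · rintro X ⟨A, C, f, g, hA, hC, hS⟩
    obtain ⟨A₁, hA₁, P, j, p, hP, hSA⟩ := hGP.exists_syzygy hA
    obtain ⟨C₁, hC₁, Q, i, q, hQ, hSC⟩ := hGP.exists_syzygy hC
    obtain ⟨φ, hφ⟩ := hS.exists_lift (extVanish_of_projective hQ 0 A) q
    obtain ⟨B₁, k, r, f₁, g₁, hU, hT⟩ := hS.exists_horseshoe_left hSA hSC φ hφ
    exact ⟨B₁, ⟨A₁, C₁, f₁, g₁, hA₁, hC₁, hT⟩, _, k, r, projective_prod hP hQ, hU⟩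

/-- A module of finite Gorenstein projective dimension embeds into a module of finite projective
dimension with Gorenstein projective cokernel. -/
lemma exists_finite_projective_dimension_hull {n : ℕ} {M : ModuleCat.{u} R} (hM : gpdLE R n M) :
    ∃ (H G : ModuleCat.{u} R) (f : M →ₗ[R] H) (g : H →ₗ[R] G), IsShortExact f g ∧
      IsGorensteinProjective R G ∧ ∀ Y, extVanish R (n + 1) H Y := by
  have hGP := isGorensteinProjectiveClass (R := R)
  induction n generalizing M with
  | zero =>
    obtain ⟨G, hG, P, f, g, hP, hS⟩ := hGP.exists_cosyzygy hM
    exact ⟨P, G, f, g, hS, hG, extVanish_of_projective hP 0⟩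
  | succ n ih =>
    obtain ⟨K, G, f, g, hG, hf, hg, hfg, hK⟩ := hM
    obtain ⟨H, L, a, b, hH, hL, hdim⟩ := ih hK
    obtain ⟨G₁, hG₁, P, j, p, hP, hSG⟩ := hGP.exists_cosyzygy hG
    obtain ⟨L₁, hL₁, Q, i, q, hQ, hSL⟩ := hGP.exists_cosyzygy hL
    obtain ⟨A, p', i₁, q₁, hA, hMA⟩ := (IsShortExact.mk hf hg hfg).exists_comp hSG
    obtain ⟨φ, hφ⟩ := hH.exists_extension (hGP.extVanish_projective hL hP) (j ∘ₗ f)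
    obtain ⟨B, k, r, f₁, g₁, hB, hAB⟩ := hH.exists_horseshoe_right hA hSL φ hφ
    obtain ⟨F, s, t, v, hF, hGF⟩ := hMA.exists_comp hAB
    exact ⟨B, F, _, s, hF, hGF.isGorensteinProjective hG₁ hL₁, fun Y =>
      hB.extVanish_right_left (hdim Y) (extVanish_of_projective (projective_prod hP hQ) _ Y)⟩

lemma extVanish_of_gpdLE_of_forall_extVanish {n : ℕ} {M : ModuleCat.{u} R} (hM : gpdLE R n M)
    (h : ∀ G, IsGorensteinProjective R G → extVanish R 1 G M) (Y : ModuleCat.{u} R) :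
    extVanish R (n + 1) M Y := by
  obtain ⟨H, G, f, g, hS, hG, hH⟩ := exists_finite_projective_dimension_hull hM
  obtain ⟨r, hr⟩ := hS.exists_extension (h G hG) LinearMap.id
  exact extVanish_of_retract_left hr (hH Y)

lemma extVanish_of_projDimLE {n m : ℕ} {M : ModuleCat.{u} R}
    (h : ∀ M : ModuleCat.{u} R, gpdLE R n M) (hM : projDimLE R m M) (k : ℕ)
    (X : ModuleCat.{u} R) : extVanish R (n + k + 1) X M := by
  induction m generalizing M k with
  | zero => exact extVanish_of_gpdLE (h X) hM k
  | succ m ih =>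
    obtain ⟨K, P, f, g, hP, hf, hg, hfg, hK⟩ := hM
    exact (IsShortExact.mk hf hg hfg).extVanish_right_right (extVanish_of_gpdLE (h X) hP k)
      (ih hK (k + 1))

lemma extVanish_add_of_forall_extVanish {n : ℕ} {M : ModuleCat.{u} R}
    (h : ∀ Y, extVanish R (n + 1) M Y) (k : ℕ) (Y : ModuleCat.{u} R) :
    extVanish R (n + k + 1) M Y := by
  induction k generalizing Y with
  | zero => exact h Y
  | succ k ih =>
    obtain ⟨C, I, f, g, hI, hS⟩ := exists_isInjectiveStep Y
    exact hS.extVanish_left_right (ih C) (extVanish_of_injective hI _ M)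

lemma extVanish_of_injective_of_gpdLE {n : ℕ} {I : ModuleCat.{u} R} (hI : Module.Injective R I)
    (h : gpdLE R n I) (Y : ModuleCat.{u} R) : extVanish R (n + 1) I Y :=
  extVanish_of_gpdLE_of_forall_extVanish h (fun G _ => extVanish_of_injective hI 0 G) Y

lemma extVanish_of_injDimLE_of_gpdLE {n m : ℕ} {M : ModuleCat.{u} R}
    (h : ∀ M : ModuleCat.{u} R, gpdLE R n M) (hM : injDimLE R m M) (k : ℕ)
    (Y : ModuleCat.{u} R) : extVanish R (n + k + 1) M Y := by
  induction m generalizing M k with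
  | zero =>
    exact extVanish_add_of_forall_extVanish (extVanish_of_injective_of_gpdLE hM (h M)) k Y
  | succ m ih =>
    obtain ⟨I, C, f, g, hI, hf, hg, hfg, hC⟩ := hM
    exact (IsShortExact.mk hf hg hfg).extVanish_left_left
      (extVanish_add_of_forall_extVanish (extVanish_of_injective_of_gpdLE hI (h I)) k Y)
      (ih hC (k + 1))

end FiniteGorensteinDimension

section Cosyzygies

variable {R : Type u} [Ring R]

/-- `X` is the `n`-th cosyzygy of `M` in some injective coresolution of `M`. -/
def IsCosyzygy : ℕ → ModuleCat.{u} R → ModuleCat.{u} R → Prop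
  | 0, M, X => M = X
  | n + 1, M, X => ∃ C, IsInjectiveStep M C ∧ IsCosyzygy n C X

lemma exists_isCosyzygy (n : ℕ) (M : ModuleCat.{u} R) : ∃ X, IsCosyzygy n M X := by
  induction n generalizing M with
  | zero => exact ⟨M, rfl⟩
  | succ n ih =>
    obtain ⟨C, hC⟩ := exists_isInjectiveStep M
    obtain ⟨X, hX⟩ := ih C
    exact ⟨X, C, hC, hX⟩

namespace IsCosyzygy

variable {n : ℕ} {M X : ModuleCat.{u} R}

lemma succ {Y : ModuleCat.{u} R} (h : IsCosyzygy n M X) (hXY : IsInjectiveStep X Y) :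
    IsCosyzygy (n + 1) M Y := by
  induction n generalizing M with
  | zero =>
    obtain rfl : M = X := h
    exact ⟨Y, hXY, rfl⟩
  | succ n ih =>
    obtain ⟨C, hC, hX⟩ := h
    exact ⟨C, hC, ih hX⟩

lemma extVanish {Z : ModuleCat.{u} R} (h : IsCosyzygy n M X)
    (hM : extVanish R (n + 1) Z M) : extVanish R 1 Z X := by
  induction n generalizing M with
  | zero =>
    obtain rfl : M = X := h
    exact hM
  | succ n ih =>
    obtain ⟨C, ⟨I, f, g, hI, hS⟩, hX⟩ := h
    exact ih hX (hS.extVanish_right_right (extVanish_of_injective hI n Z) hM)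

lemma injDimLE (h : IsCosyzygy n M X) (hX : Module.Injective R X) : injDimLE R n M := by
  induction n generalizing M with
  | zero =>
    obtain rfl : M = X := h
    exact hX
  | succ n ih =>
    obtain ⟨C, ⟨I, f, g, hI, hS⟩, hC⟩ := h
    exact ⟨I, C, f, g, hI, hS.injective, hS.surjective, hS.range_eq_ker, ih hC⟩

lemma exists_horseshoe {K P : ModuleCat.{u} R} {f : K →ₗ[R] P} {g : P →ₗ[R] M}
    (h : IsCosyzygy n M X) (hS : IsShortExact f g) :
    ∃ (K' P' : ModuleCat.{u} R) (f' : K' →ₗ[R] P') (g' : P' →ₗ[R] X),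
      IsCosyzygy n K K' ∧ IsCosyzygy n P P' ∧ IsShortExact f' g' := by
  induction n generalizing K P M with
  | zero =>
    obtain rfl : M = X := h
    exact ⟨K, P, f, g, rfl, rfl, hS⟩
  | succ n ih =>
    obtain ⟨C, ⟨I, i, q, hI, hM⟩, hC⟩ := h
    obtain ⟨K₁, J, j, p, hJ, hK⟩ := exists_isInjectiveStep K
    obtain ⟨φ, hφ⟩ := hS.exists_extension (extVanish_of_injective hJ 0 M) j
    obtain ⟨P₁, k, r, f₁, g₁, hP, hT⟩ := hS.exists_horseshoe_right hK hM φ hφ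
    obtain ⟨K', P', f', g', hK', hP', hS'⟩ := ih hC hT
    exact ⟨K', P', f', g', ⟨K₁, ⟨J, j, p, hJ, hK⟩, hK'⟩,
      ⟨P₁, ⟨_, k, r, injective_prod hJ hI, hP⟩, hP'⟩, hS'⟩

/-- If projective modules have injective dimension at most `n` and injective modules have
projective dimension at most `n`, then `n`-th cosyzygies are Gorenstein injective. -/
lemma isGorensteinInjective (h : IsCosyzygy n M X)
    (hproj : ∀ P : ModuleCat.{u} R, Module.Projective R P → ∀ Z, _root_.extVanish R (n + 1) Z P)
    (hinj : ∀ I : ModuleCat.{u} R, Module.Injective R I → ∀ Z, _root_.extVanish R (n + 1) I Z) :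
    IsGorensteinInjective R X := by
  refine IsGorensteinInjectiveClass.isGorensteinInjective
    (E := fun X => ∃ M, IsCosyzygy n M X) ⟨?_, ?_, ?_⟩ ⟨M, h⟩
  · rintro X ⟨M, h⟩ I hI
    exact h.extVanish (hinj I hI M)
  · rintro X ⟨M, h⟩
    obtain ⟨Y, hXY⟩ := exists_isInjectiveStep X
    obtain ⟨C, -, hC⟩ := h.succ hXY
    exact ⟨Y, ⟨C, hC⟩, hXY⟩
  · rintro X ⟨M, h⟩
    obtain ⟨K, P, f, g, hP, hS⟩ := exists_isProjectiveStep M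
    obtain ⟨K', P', f', g', hK', hP', hS'⟩ := h.exists_horseshoe hS
    exact ⟨K', ⟨K, hK'⟩, P', f', g',
      injective_of_extVanish fun Z => hP'.extVanish (hproj P hP Z), hS'⟩

/-- The left orthogonal class of the Gorenstein injective modules is closed under cosyzygies. -/
lemma forall_extVanish (h : IsCosyzygy n M X)
    (hM : ∀ G, IsGorensteinInjective R G → _root_.extVanish R 1 M G) :
    ∀ G, IsGorensteinInjective R G → _root_.extVanish R 1 X G := by
  induction n generalizing M with
  | zero =>
    obtain rfl : M = X := h
    exact hM
  | succ n ih =>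
    obtain ⟨C, ⟨I, f, g, hI, hS⟩, hX⟩ := h
    refine ih hX fun G hG => ?_
    obtain ⟨K, hK, J, a, b, hJ, hT⟩ := isGorensteinInjectiveClass.exists_syzygy hG
    exact hT.extVanish_right_right (extVanish_of_injective hJ 0 C)
      (hS.extVanish_right_left (hM K hK) (hK.injective_extVanish hI 1))

end IsCosyzygy

lemma IsGorensteinInjective.injective {G : ModuleCat.{u} R} (hG : IsGorensteinInjective R G)
    (h : ∀ K, IsGorensteinInjective R K → extVanish R 1 G K) : Module.Injective R G := by
  obtain ⟨K, hK, I, f, g, hI, hS⟩ := isGorensteinInjectiveClass.exists_syzygy hG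
  obtain ⟨s, hs⟩ := hS.exists_lift (h K hK) LinearMap.id
  exact injective_of_extVanish fun X =>
    extVanish_of_retract_right hs (extVanish_of_injective hI 0 X)

end Cosyzygies

/-- If the left Gorenstein global dimension of `R` is finite, then
`GP(R)^⊥ = {finite projective dimension} = {finite injective dimension} = ^⊥GI(R)`. -/
theorem gpPerp_eq_finite_dims_eq_giLeftPerp (R : Type u) [Ring R]
    (h : ∃ n : ℕ, ∀ M : ModuleCat.{u} R, gpdLE R n M) :
    (∀ M : ModuleCat.{u} R,
      (∀ G, IsGorensteinProjective R G → extVanish R 1 G M) ↔ ∃ n : ℕ, projDimLE R n M) ∧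
    (∀ M : ModuleCat.{u} R,
      (∃ n : ℕ, projDimLE R n M) ↔ ∃ n : ℕ, injDimLE R n M) ∧
    (∀ M : ModuleCat.{u} R,
      (∃ n : ℕ, injDimLE R n M) ↔ ∀ G, IsGorensteinInjective R G → extVanish R 1 M G) := by
  obtain ⟨n, h⟩ := h
  refine ⟨fun M => ⟨fun hM => ⟨n, projDimLE_of_extVanish
      (extVanish_of_gpdLE_of_forall_extVanish (h M) hM)⟩,
      fun ⟨m, hM⟩ G hG => hG.extVanish_of_projDimLE hM 0⟩,
    fun M => ⟨fun ⟨m, hM⟩ => ⟨n, injDimLE_of_extVanish (extVanish_of_projDimLE h hM 0)⟩,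
      fun ⟨m, hM⟩ => ⟨n, projDimLE_of_extVanish (extVanish_of_injDimLE_of_gpdLE h hM 0)⟩⟩,
    fun M => ⟨fun ⟨m, hM⟩ G hG => hG.extVanish_of_injDimLE hM 0, fun hM => ⟨n, ?_⟩⟩⟩
  obtain ⟨X, hX⟩ := exists_isCosyzygy n M
  have hG := hX.isGorensteinInjective (fun P hP Z => extVanish_of_gpdLE (h Z) hP 0)
    (fun I hI Z => extVanish_of_injective_of_gpdLE hI (h I) Z)
  exact hX.injDimLE (hG.injective (hX.forall_extVanish hM))
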